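/- arXiv:1211.0589 — 2 statements merged into one kernel-verified Lean document; each statement's English description precedes it below -/
import Mathlib

section
/- For any connected, unweighted, d-regular finite graph G on n vertices and any k with 1 ≤ k ≤ n, the k-th smallest eigenvalue of the normalized Laplacian satisfies λ_k ≥ (k−1)²/(100n²). -/
/-- The normalized Laplacian `I - D^{-1/2} A D^{-1/2}` of a finite simple graph. -/
noncomputable def normLapG {n : ℕ} (G : SimpleGraph (Fin n)) [DecidableRel G.Adj] :
    Matrix (Fin n) (Fin n) ℝ :=
  Matrix.of fun x y =>
    (if x = y then (1 : ℝ) else 0) -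
      (if G.Adj x y then (1 : ℝ) else 0) /
        (Real.sqrt (G.degree x) * Real.sqrt (G.degree y))

open Matrix in
lemma spectral_data {n : ℕ} (L : Matrix (Fin n) (Fin n) ℝ) (hL : L.IsHermitian) :
    ∃ U : Matrix (Fin n) (Fin n) ℝ, Uᵀ * U = 1 ∧ U * Uᵀ = 1 ∧
      L = U * diagonal hL.eigenvalues * Uᵀ := by
  refine ⟨hL.eigenvectorUnitary, ?_, ?_, ?_⟩
  · have := Unitary.coe_star_mul_self hL.eigenvectorUnitary
    rwa [star_eq_conjTranspose, conjTranspose_eq_transpose_of_trivial] at this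
  · rw [mul_eq_one_comm]
    have := Unitary.coe_star_mul_self hL.eigenvectorUnitary
    rwa [star_eq_conjTranspose, conjTranspose_eq_transpose_of_trivial] at this
  · have := hL.spectral_theorem
    rw [Unitary.conjStarAlgAut_apply, star_eq_conjTranspose, conjTranspose_eq_transpose_of_trivial] at this
    exact this

open Matrix in
lemma trace_sq_eig {n : ℕ} (L : Matrix (Fin n) (Fin n) ℝ) (hL : L.IsHermitian) :
    (L * L).trace = ∑ i, hL.eigenvalues i ^ 2 := by
  obtain ⟨U, h1, h2, h3⟩ := spectral_data L hL
  have : L * L = U * (diagonal hL.eigenvalues * diagonal hL.eigenvalues) * Uᵀ := by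
    conv_lhs => rw [h3]
    calc _ = U * diagonal hL.eigenvalues * (Uᵀ * U) * diagonal hL.eigenvalues * Uᵀ := by
          simp only [Matrix.mul_assoc]
      _ = _ := by rw [h1]; simp only [Matrix.mul_assoc, Matrix.one_mul, Matrix.mul_one]
  rw [this, Matrix.trace_mul_comm, ← Matrix.mul_assoc, h1, Matrix.one_mul, diagonal_mul_diagonal,
    trace_diagonal]
  simp [sq]

open Matrix in
lemma courant {n : ℕ} (L : Matrix (Fin n) (Fin n) ℝ) (hL : L.IsHermitian)
    (lam : Fin n → ℝ) (hmono : Monotone lam) (σ : Equiv.Perm (Fin n))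
    (hσ : lam = hL.eigenvalues ∘ σ) (k : Fin n) (S : Finset (Fin n)) (hS : S.card ≤ k) :
    ∃ f : Fin n → ℝ, (∀ x ∈ S, f x = 0) ∧ 0 < ∑ x, f x ^ 2 ∧
      f ⬝ᵥ (L *ᵥ f) ≤ lam k * ∑ x, f x ^ 2 := by
  obtain ⟨U, h1, h2, h3⟩ := spectral_data L hL
  let I := {i : Fin n // i ≤ k}
  let ext : (I → ℝ) →ₗ[ℝ] (Fin n → ℝ) := 
    { toFun := fun c i => if h : σ.symm i ≤ k then c ⟨_, h⟩ else 0
      map_add' := by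
        intro a b; ext i; dsimp only [Pi.add_apply]; split_ifs <;> simp
      map_smul' := by
        intro a b; ext i; simp }
  let Φ : (I → ℝ) →ₗ[ℝ] (S → ℝ) := 
    (LinearMap.funLeft ℝ ℝ (fun x : S => (x : Fin n))) ∘ₗ U.mulVecLin ∘ₗ ext
  have hker : LinearMap.ker Φ ≠ ⊥ := by
    apply LinearMap.ker_ne_bot_of_finrank_lt
    have : Fintype.card I = k + 1 := by
      rw [Fintype.card_subtype]
      have : (Finset.univ.filter (fun i : Fin n => i ≤ k)) = Finset.Iic k := by ext; simp
      rw [this, Fin.card_Iic]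
    simp only [Module.finrank_fintype_fun_eq_card, Fintype.card_coe, this]
    omega
  obtain ⟨c, hc, hc0⟩ := Submodule.exists_mem_ne_zero_of_ne_bot hker
  rw [LinearMap.mem_ker] at hc
  set e := ext c with he
  have hee : ∀ i, e (σ i) = if h : i ≤ k then c ⟨i, h⟩ else 0 := by
    intro i; simp [he, ext]
  have hff : (U *ᵥ e) ⬝ᵥ (U *ᵥ e) = e ⬝ᵥ e := by
    rw [Matrix.dotProduct_mulVec, Matrix.vecMul_mulVec, h1, Matrix.vecMul_one] 
  have hLf : (U *ᵥ e) ⬝ᵥ (L *ᵥ (U *ᵥ e)) = ∑ i, lam i * e (σ i) ^ 2 := by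
    have : L *ᵥ (U *ᵥ e) = U *ᵥ (diagonal hL.eigenvalues *ᵥ e) := by
      conv_lhs => rw [h3]
      rw [Matrix.mulVec_mulVec, Matrix.mul_assoc, h1, Matrix.mul_one, Matrix.mulVec_mulVec]
    rw [this, Matrix.dotProduct_mulVec, Matrix.vecMul_mulVec, h1, Matrix.vecMul_one]
    unfold dotProduct
    rw [← Equiv.sum_comp σ (fun i => e i * (diagonal hL.eigenvalues *ᵥ e) i)]
    refine Finset.sum_congr rfl fun i _ => ?_
    simp [hσ, mulVec_diagonal]; ring
  have hsq : ∑ x, (U *ᵥ e) x ^ 2 = ∑ i, e (σ i) ^ 2 := by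
    rw [Equiv.sum_comp σ (fun i => e i ^ 2)]
    simpa [dotProduct, sq] using hff
  refine ⟨U *ᵥ e, ?_, ?_, ?_⟩
  · intro x hx
    exact congrFun hc ⟨x, hx⟩
  · rw [hsq]
    obtain ⟨i, hi⟩ := Function.ne_iff.1 hc0
    refine Finset.sum_pos' (fun _ _ => sq_nonneg _) ⟨i.1, Finset.mem_univ _, ?_⟩
    rw [hee, dif_pos i.2]
    have : c i ≠ 0 := hi
    positivity
  · rw [hLf, hsq, Finset.mul_sum]
    refine Finset.sum_le_sum fun i _ => ?_
    by_cases h : i ≤ k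
    · exact mul_le_mul_of_nonneg_right (hmono h) (sq_nonneg _)
    · rw [hee, dif_neg h]; simp

lemma normLap_apply {n : ℕ} (G : SimpleGraph (Fin n)) [DecidableRel G.Adj]
    (d : ℕ) (hreg : G.IsRegularOfDegree d) (x y : Fin n) :
    normLapG G x y = (if x = y then (1 : ℝ) else 0) - (if G.Adj x y then (1 : ℝ) else 0) / d := by
  simp only [normLapG, Matrix.of_apply, hreg x, hreg y]
  rw [Real.mul_self_sqrt (by positivity)]

lemma sum_adj {n : ℕ} (G : SimpleGraph (Fin n)) [DecidableRel G.Adj]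
    (d : ℕ) (hreg : G.IsRegularOfDegree d) (x : Fin n) :
    ∑ y, (if G.Adj x y then (1 : ℝ) else 0) = d := by
  rw [Finset.sum_boole, ← hreg x, ← G.card_neighborFinset_eq_degree, G.neighborFinset_eq_filter]

open Matrix in
lemma quad {n : ℕ} (G : SimpleGraph (Fin n)) [DecidableRel G.Adj]
    (d : ℕ) (hd : 1 ≤ d) (hreg : G.IsRegularOfDegree d) (f : Fin n → ℝ) :
    2 * d * (f ⬝ᵥ (normLapG G *ᵥ f)) = 
      ∑ x, ∑ y, (if G.Adj x y then (1 : ℝ) else 0) * (f x - f y) ^ 2 := by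
  have hd' : (d : ℝ) ≠ 0 := by positivity
  have e1 : ∑ x, ∑ y, (if G.Adj x y then (1 : ℝ) else 0) * f x ^ 2 = d * ∑ x, f x ^ 2 := by
    rw [Finset.mul_sum]
    refine Finset.sum_congr rfl fun x _ => ?_
    rw [← Finset.sum_mul, sum_adj G d hreg]
  have e2 : ∑ x, ∑ y, (if G.Adj x y then (1 : ℝ) else 0) * f y ^ 2 = d * ∑ x, f x ^ 2 := by
    rw [Finset.sum_comm, ← e1]
    refine Finset.sum_congr rfl fun x _ => Finset.sum_congr rfl fun y _ => ?_
    simp only [G.adj_comm]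
  have e3 : d * (f ⬝ᵥ (normLapG G *ᵥ f)) = d * ∑ x, f x ^ 2 - 
      ∑ x, ∑ y, (if G.Adj x y then (1 : ℝ) else 0) * (f x * f y) := by
    simp only [dotProduct, mulVec, normLap_apply G d hreg]
    rw [Finset.mul_sum, Finset.mul_sum, ← Finset.sum_sub_distrib]
    refine Finset.sum_congr rfl fun x _ => ?_
    have : ∑ y, ((if x = y then (1 : ℝ) else 0) - (if G.Adj x y then (1 : ℝ) else 0) / d) * f y
       = f x - (∑ y, (if G.Adj x y then (1 : ℝ) else 0) * f y) / d := by
      simp only [sub_mul, Finset.sum_sub_distrib, Finset.sum_div]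
      congr 1
      · simp
      · exact Finset.sum_congr rfl fun y _ => by ring
    rw [this]
    have : ∑ y, (if G.Adj x y then (1 : ℝ) else 0) * (f x * f y) = 
       f x * ∑ y, (if G.Adj x y then (1 : ℝ) else 0) * f y := by
      rw [Finset.mul_sum]
      exact Finset.sum_congr rfl fun y _ => by ring
    rw [this]
    field_simp
  have e4 : ∑ x, ∑ y, (if G.Adj x y then (1 : ℝ) else 0) * (f x - f y) ^ 2 = 
     ∑ x, ∑ y, (if G.Adj x y then (1 : ℝ) else 0) * f x ^ 2 + 
     ∑ x, ∑ y, (if G.Adj x y then (1 : ℝ) else 0) * f y ^ 2 - 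
     2 * ∑ x, ∑ y, (if G.Adj x y then (1 : ℝ) else 0) * (f x * f y) := by
    simp only [Finset.mul_sum, ← Finset.sum_add_distrib, ← Finset.sum_sub_distrib]
    exact Finset.sum_congr rfl fun x _ => Finset.sum_congr rfl fun y _ => by ring
  rw [e4, e1, e2]
  linarith

open Matrix in
lemma eig_sum {n : ℕ} (G : SimpleGraph (Fin n)) [DecidableRel G.Adj]
    (d : ℕ) (hd : 1 ≤ d) (hreg : G.IsRegularOfDegree d) (hL : (normLapG G).IsHermitian) :
    ∑ i, (1 - hL.eigenvalues i) ^ 2 = (n : ℝ) / d := by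
  have hd' : (d : ℝ) ≠ 0 := by positivity
  have h1 := trace_sq_eig _ hL
  have h2 := hL.trace_eq_sum_eigenvalues
  have h3 : (normLapG G).trace = n := by
    simp [Matrix.trace, normLap_apply G d hreg]
  have h4 : (normLapG G * normLapG G).trace = n + n / d := by
    simp only [Matrix.trace, diag_apply, mul_apply]
    have : ∀ x : Fin n, ∑ y, normLapG G x y * normLapG G y x = 1 + 1 / d := by
      intro x
      have : ∀ y, normLapG G x y * normLapG G y x = (if x = y then (1 : ℝ) else 0) + 
          (if G.Adj x y then (1 : ℝ) else 0) / d ^ 2 := by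
        intro y
        rw [normLap_apply G d hreg, normLap_apply G d hreg]
        by_cases h : x = y
        · subst h; simp
        · by_cases h' : G.Adj x y
          · simp [h, h', h'.symm, Ne.symm h]; field_simp
          · have : ¬ G.Adj y x := fun h => h' h.symm
            simp [h, h', this]
      simp only [this, Finset.sum_add_distrib, ← Finset.sum_div, sum_adj G d hreg]
      simp
      field_simp
    simp only [this]
    simp; ring
  have : ∀ i, (1 - hL.eigenvalues i) ^ 2 = 1 - 2 * hL.eigenvalues i + hL.eigenvalues i ^ 2 := 
    fun i => by ring
  simp only [this, Finset.sum_add_distrib, Finset.sum_sub_distrib, ← Finset.mul_sum]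
  rw [← h1, h4]
  have h5 : ∑ i, hL.eigenvalues i = n := by
    rw [← h3, h2]; simp
  rw [h5]; simp; ring

lemma tree_step {V : Type*} [Fintype V] [DecidableEq V] (G : SimpleGraph V) [DecidableRel G.Adj]
    (d : ℕ) (hreg : G.IsRegularOfDegree d) (hconn : G.Connected) (ρ : V)
    (U T : Finset V) (p : V → V) (r g : V → ℕ)
    (hρ : ρ ∈ U)
    (hp : ∀ x ∈ U, x ≠ ρ → p x ∈ U ∧ G.Adj x (p x) ∧ r (p x) < r x ∧ (x ∉ T → g (p x) < g x))
    (hg : ∀ x ∈ U, g x ≤ 2) (hT : T.card * (d + 1) ≤ U.card) (hTU : T ⊆ U) :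
    ∃ (T : Finset V) (p : V → V) (r g : V → ℕ), 
      (∀ x, x ≠ ρ → G.Adj x (p x) ∧ r (p x) < r x ∧ (x ∉ T → g (p x) < g x)) ∧
      (∀ x, g x ≤ 3) ∧ T.card * (d + 1) ≤ Fintype.card V := by
  induction hm : Fintype.card V - U.card using Nat.strong_induction_on generalizing U T p r g with
  | _ m ih =>
  by_cases hall : ∀ x, x ∉ U → ∃ y ∈ U, G.Adj x y
  · choose! q hq using hall
    let M := U.sup r
    refine ⟨T, fun x => if x ∈ U then p x else q x, fun x => if x ∈ U then r x else M + 1,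
      fun x => if x ∈ U then g x else 3, ?_, ?_, hT.trans (Finset.card_le_univ U)⟩
    · intro x hx
      by_cases hxU : x ∈ U
      · obtain ⟨h1, h2, h3, h4⟩ := hp x hxU hx
        simp only [hxU, h1, if_true]
        exact ⟨h2, h3, h4⟩
      · obtain ⟨h1, h2⟩ := hq x hxU
        simp only [hxU, h1, if_true, if_false]
        have := hg _ h1
        have h3 : r (q x) ≤ M := Finset.le_sup (f := r) h1
        exact ⟨h2, by omega, fun _ => by omega⟩
    · intro x
      by_cases hxU : x ∈ U
      · have := hg _ hxU
        simp only [hxU, if_true]; omega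
      · simp [hxU]
  · push Not at hall
    -- find c at distance two
    obtain ⟨c0, hc0, hc0'⟩ := hall
    obtain ⟨t, c, a, ha, ht, hta, htc, hcU, hcn⟩ : ∃ t c a, a ∈ U ∧ t ∉ U ∧ G.Adj t a ∧ G.Adj t c ∧
        c ∉ U ∧ ∀ y ∈ U, ¬ G.Adj c y := by
      let W : Set V := {v | v ∈ U ∨ ∃ y ∈ U, G.Adj v y}
      obtain ⟨w⟩ := hconn.preconnected ρ c0
      obtain ⟨e, he, h1, h2⟩ := w.exists_boundary_dart W (Or.inl hρ) (by
        rintro (h | ⟨y, hy, h⟩)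
        · exact hc0 h
        · exact hc0' y hy h)
      have hadj := e.adj
      have hfU : e.fst ∉ U := fun h => h2 (Or.inr ⟨_, h, hadj.symm⟩)
      rcases h1 with h1 | ⟨a, ha, h1⟩
      · exact absurd h1 hfU
      · exact ⟨e.fst, e.snd, a, ha, hfU, h1, hadj, fun h => h2 (Or.inl h),
          fun y hy h => h2 (Or.inr ⟨y, hy, h⟩)⟩
    let M := U.sup r
    let N : Finset V := insert c (G.neighborFinset c)
    have hN : N.card = d + 1 := by
      rw [Finset.card_insert_of_notMem (by simp), G.card_neighborFinset_eq_degree, hreg c]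
    have hdisj : Disjoint U N := by
      rw [Finset.disjoint_left]
      intro x hx hxN
      rcases Finset.mem_insert.1 hxN with h | h
      · exact hcU (h ▸ hx)
      · exact hcn x hx (by simpa using h)
    have hUN : (U ∪ N).card = U.card + (d + 1) := by
      rw [Finset.card_union_of_disjoint hdisj, hN]
    have hle : (U ∪ N).card ≤ Fintype.card V := Finset.card_le_univ _
    have htN : t ∈ N := by simp [N, htc.symm]
    have hcN : c ∈ N := by simp [N]
    have hct : c ≠ t := htc.ne'
    have hrM : ∀ x ∈ U, r x ≤ M := fun x hx => Finset.le_sup (f := r) hx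
    have hNU : ∀ x ∈ N, x ∉ U := fun x hx hxU => (Finset.disjoint_left.1 hdisj) hxU hx
    refine ih _ ?_ (U ∪ N) (insert t T)
      (fun x => if x ∈ U then p x else if x = t then a else if x = c then t else c)
      (fun x => if x ∈ U then r x else if x = t then M + 1 else if x = c then M + 2 else M + 3)
      (fun x => if x ∈ U then g x else if x = t then 0 else if x = c then 1 else 2)
      (Finset.mem_union_left _ hρ) ?_ ?_ ?_ ?_ rfl
    · omega
    · intro x hx hxρ
      by_cases hxU : x ∈ U
      · obtain ⟨h1, h2, h3, h4⟩ := hp x hxU hxρ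
        simp only [hxU, h1, if_true]
        exact ⟨Finset.mem_union_left _ h1, h2, h3, fun h => h4 fun h' => h (Finset.mem_insert_of_mem h')⟩
      · by_cases hxt : x = t
        · subst hxt
          simp only [hxU, ha, if_true, if_false]
          exact ⟨Finset.mem_union_left _ ha, hta, by have := hrM a ha; omega, fun h => absurd (Finset.mem_insert_self _ _) h⟩
        · by_cases hxc : x = c
          · subst hxc
            simp only [hxU, ht, hxt, if_true, if_false]
            exact ⟨Finset.mem_union_right _ htN, htc.symm, by omega, fun _ => by omega⟩
          · simp only [hxU, hxt, hxc, hcU, hct, if_true, if_false]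
            have hxN : x ∈ N := (Finset.mem_union.1 hx).resolve_left hxU
            have : G.Adj c x := by simpa [N, hxc] using hxN
            exact ⟨Finset.mem_union_right _ hcN, this.symm, by omega, fun _ => by omega⟩
    · intro x hx
      have := hg x
      split_ifs <;> first | omega | exact this ‹_›
    · have : (insert t T).card ≤ T.card + 1 := Finset.card_insert_le _ _
      rw [hUN]
      nlinarith
    · intro x hx
      rcases Finset.mem_insert.1 hx with h | h
      · exact h ▸ Finset.mem_union_right _ htN
      · exact Finset.mem_union_left _ (hTU h)

lemma tree_exists {V : Type*} [Fintype V] [DecidableEq V] (G : SimpleGraph V) [DecidableRel G.Adj]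
    (d : ℕ) (hreg : G.IsRegularOfDegree d) (hconn : G.Connected) (ρ : V) :
    ∃ (T : Finset V) (p : V → V) (r g : V → ℕ), 
      (∀ x, x ≠ ρ → G.Adj x (p x) ∧ r (p x) < r x ∧ (x ∉ T → g (p x) < g x)) ∧
      (∀ x, g x ≤ 3) ∧ T.card * (d + 1) ≤ Fintype.card V := by
  refine tree_step G d hreg hconn ρ (insert ρ (G.neighborFinset ρ)) {ρ} (fun _ => ρ)
    (fun x => if x = ρ then 0 else 1) (fun x => if x = ρ then 0 else 1) (by simp) ?_ ?_ ?_ (by simp)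
  · intro x hx hxρ
    have : G.Adj ρ x := by simpa [hxρ] using hx
    simp [hxρ, this.symm]
  · intro x _
    split_ifs <;> omega
  · rw [Finset.card_insert_of_notMem (by simp), G.card_neighborFinset_eq_degree, hreg ρ]
    simp

/-- recursion along parents -/
lemma rec_up {V α : Type*} [DecidableEq V] (ρ : V) (p : V → V) (r : V → ℕ)
    (hp : ∀ x, x ≠ ρ → r (p x) < r x) (S : Finset V) (hS : ρ ∈ S) (z : α) (F : V → α → α) :
    ∃ D : V → α, (∀ v ∈ S, D v = z) ∧ ∀ v, v ∉ S → D v = F v (D (p v)) := by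
  classical
  let wf : WellFounded (fun x y : V => r x < r y) := (measure r).wf
  let D : V → α := wf.fix (fun v ih => if h : v ∈ S then z else
    F v (ih (p v) (hp v (fun e => h (e ▸ hS)))))
  refine ⟨D, ?_, ?_⟩
  · intro v hv
    simp only [D]
    rw [wf.fix_eq]; simp [hv]
  · intro v hv
    simp only [D]
    rw [wf.fix_eq]; simp [hv]

lemma res_exists {V : Type*} [Fintype V] [DecidableEq V] (ρ : V) (p : V → V) (r : V → ℕ)
    (hp : ∀ x, x ≠ ρ → r (p x) < r x) (w : V → ℝ) (s : ℝ) :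
    ∃ R : V → ℝ, ∀ v, R v = w v + ∑ u, if u ≠ ρ ∧ p u = v ∧ R u ≤ s then R u else 0 := by
  classical
  let M := Finset.univ.sup r
  have hM : ∀ x, r x ≤ M := fun x => Finset.le_sup (f := r) (Finset.mem_univ x)
  let wf : WellFounded (fun x y : V => M - r x < M - r y) := (measure (fun x => M - r x)).wf
  let R : V → ℝ := wf.fix (fun v ih => w v + ∑ u, if h : u ≠ ρ ∧ p u = v then
    (let a := ih u (by have h1 := hp u h.1; have h2 := hM u; rw [h.2] at h1; omega); 
      if a ≤ s then a else 0) else 0)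
  refine ⟨R, fun v => ?_⟩
  conv_lhs => simp only [R]
  rw [wf.fix_eq]
  congr 1
  refine Finset.sum_congr rfl fun u _ => ?_
  by_cases h : u ≠ ρ ∧ p u = v
  · rw [dif_pos h]
    change (if R u ≤ s then R u else 0) = _
    simp only [h.1, h.2, ne_eq, not_false_eq_true, true_and]
  · rw [dif_neg h, if_neg]
    tauto

lemma poincare {V : Type*} [Fintype V] [DecidableEq V] (ρ : V) (p : V → V) (r g : V → ℕ)
    (T : Finset V) (d n : ℕ) (j : ℕ) (hj : 1 ≤ j) (hn : 1 ≤ n) (hcard : Fintype.card V = n)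
    (hp : ∀ x, x ≠ ρ → r (p x) < r x ∧ (x ∉ T → g (p x) < g x))
    (hg : ∀ x, g x ≤ 3) (hT : T.card * (d + 1) ≤ n) (hd : (d : ℝ) * j ≤ 2 * n) :
    ∃ S : Finset V, S.card ≤ j ∧ ∀ f : V → ℝ, (∀ x ∈ S, f x = 0) →
      d * j ^ 2 * ∑ x, f x ^ 2 ≤ 28 * n ^ 2 * ∑ x, (if x ≠ ρ then (f x - f (p x)) ^ 2 else 0) := by
  classical
  have hj' : (0 : ℝ) < j := by exact_mod_cast hj
  have hn' : (0 : ℝ) < n := by exact_mod_cast hn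
  have hp1 : ∀ x, x ≠ ρ → r (p x) < r x := fun x hx => (hp x hx).1
  set s : ℝ := 2 * n / j with hs
  have hsj : s * j = 2 * n := by rw [hs]; field_simp
  have hs0 : 0 < s := by positivity
  have hds : (d : ℝ) ≤ s := by rw [hs, le_div_iff₀ hj']; exact hd
  let w : V → ℝ := fun v => 1 + if v ∈ T then (d : ℝ) else 0
  have hw : ∀ v, 1 ≤ w v := fun v => by
    simp only [w]; split_ifs <;> simp
  have hwsum : ∑ v, w v ≤ 2 * n := by
    simp only [w, Finset.sum_add_distrib, Finset.sum_ite_mem, Finset.univ_inter, Finset.sum_const,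
      Finset.card_univ, hcard, nsmul_eq_mul, mul_one]
    have : (T.card : ℝ) * (d + 1) ≤ n := by exact_mod_cast hT
    have : (0 : ℝ) ≤ T.card := by positivity
    nlinarith
  obtain ⟨R, hR⟩ := res_exists ρ p r hp1 w s
  have hRw0 : ∀ v, 0 ≤ R v := by
    intro v
    induction hm : (Finset.univ.sup r - r v) using Nat.strong_induction_on generalizing v with
    | _ m ih =>
    rw [hR]
    refine add_nonneg (by linarith [hw v]) (Finset.sum_nonneg fun u _ => ?_)
    split_ifs with h
    · refine ih _ ?_ u rfl
      have h1 := hp1 u h.1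
      have h2 : r u ≤ Finset.univ.sup r := Finset.le_sup (f := r) (Finset.mem_univ u)
      rw [h.2.1] at h1; omega
    · exact le_rfl
  have hRw : ∀ v, w v ≤ R v := by
    intro v
    rw [hR]
    refine le_add_of_nonneg_right (Finset.sum_nonneg fun u _ => ?_)
    split_ifs
    · exact hRw0 u
    · exact le_rfl
  let S : Finset V := Finset.univ.filter (fun v => v = ρ ∨ s < R v)
  have hSmem : ∀ v, v ∈ S ↔ (v = ρ ∨ s < R v) := fun v => by simp [S]
  have hρS : ρ ∈ S := by simp [S]
  have hnS : ∀ v, v ∉ S ↔ (v ≠ ρ ∧ R v ≤ s) := fun v => by rw [hSmem]; push Not; rfl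
  have hRp : ∀ v, v ∉ S → w (p v) + R v ≤ R (p v) := by
    intro v hv
    rw [hR (p v)]
    have h := Finset.single_le_sum (f := fun u => if u ≠ ρ ∧ p u = p v ∧ R u ≤ s then R u else 0)
      (fun u _ => by
        split_ifs
        · exact hRw0 u
        · exact le_rfl) (Finset.mem_univ v)
    have hv' := (hnS v).1 hv
    simp only [hv'.1, hv'.2, ne_eq, not_false_eq_true, true_and, and_self, if_true] at h
    simp only [ne_eq] at h ⊢
    linarith
  -- summation identity
  have hsumm : ∀ D : V → ℝ, ∑ v, D v * w v = ∑ v, D v * R v - ∑ u, if u ∉ S then D (p u) * R u else 0 := by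
    intro D
    have h1 : ∀ v, D v * R v = D v * w v + ∑ u, if u ∉ S ∧ p u = v then D (p u) * R u else 0 := by
      intro v
      conv_lhs => rw [hR v]
      rw [mul_add, Finset.mul_sum]
      congr 1
      refine Finset.sum_congr rfl fun u _ => ?_
      by_cases h : p u = v
      · by_cases h' : u ∈ S
        · have : ¬ (u ≠ ρ ∧ p u = v ∧ R u ≤ s) := fun hh => (hnS u).2 ⟨hh.1, hh.2.2⟩ h'
          rw [if_neg this, if_neg (fun hh => hh.1 h'), mul_zero]
        · have hh := (hnS u).1 h'
          rw [if_pos ⟨hh.1, h, hh.2⟩, if_pos ⟨h', h⟩, h]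
      · rw [if_neg (fun hh => h hh.2.1), if_neg (fun hh => h hh.2), mul_zero]
    have h2 : ∑ v, D v * R v = ∑ v, D v * w v + ∑ v, ∑ u, if u ∉ S ∧ p u = v then D (p u) * R u else 0 := by
      rw [← Finset.sum_add_distrib]
      exact Finset.sum_congr rfl fun v _ => h1 v
    rw [h2, Finset.sum_comm]
    have h3 : ∀ u, (∑ v, if u ∉ S ∧ p u = v then D (p u) * R u else 0) = if u ∉ S then D (p u) * R u else 0 := by
      intro u
      by_cases h : u ∈ S <;> simp [h]
    simp only [h3]
    ring
  refine ⟨S, ?_, ?_⟩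
  · have h := hsumm (fun _ => 1)
    simp only [one_mul] at h
    have h2 : ∑ v, R v - (∑ u, if u ∉ S then R u else 0) = ∑ v ∈ S, R v := by
      rw [← Finset.sum_sub_distrib, ← Finset.univ_inter S, ← Finset.sum_ite_mem]
      refine Finset.sum_congr rfl fun v _ => ?_
      by_cases hv : v ∈ S <;> simp [hv]
    have h3 : ∑ v ∈ S.erase ρ, s ≤ ∑ v ∈ S.erase ρ, R v := by
      refine Finset.sum_le_sum fun v hv => ?_
      have := Finset.mem_erase.1 hv
      have := ((hSmem v).1 this.2).resolve_left this.1
      exact this.le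
    have h4 := Finset.add_sum_erase S R hρS
    have h5 := Finset.card_erase_add_one hρS
    rw [Finset.sum_const, nsmul_eq_mul] at h3
    have h6 : ((S.erase ρ).card : ℝ) * s < j * s := by
      have := hw ρ
      have := hRw ρ
      linarith
    have h7 : (S.erase ρ).card < j := by
      exact_mod_cast lt_of_mul_lt_mul_right h6 hs0.le
    omega
  intro f hf
  obtain ⟨D, hD0, hD⟩ := rec_up ρ p r hp1 S hρS (0 : ℝ) (fun v x => x + (f v - f (p v)) ^ 2)
  obtain ⟨l, hl0, hl⟩ := rec_up ρ p r hp1 S hρS (0 : ℝ) (fun v x => x + 1)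
  obtain ⟨Q, hQ0, hQ⟩ := rec_up ρ p r hp1 S hρS (0 : ℝ) (fun v x => x + w v)
  have ind : ∀ P : V → Prop, (∀ v ∈ S, P v) → (∀ v, v ∉ S → P (p v) → P v) → ∀ v, P v := by
    intro P h1 h2 v
    induction hm : r v using Nat.strong_induction_on generalizing v with
    | _ m ih =>
    by_cases hv : v ∈ S
    · exact h1 v hv
    · refine h2 v hv (ih _ ?_ _ rfl)
      have := hp1 v ((hnS v).1 hv).1
      omega
  have hDl : ∀ v, 0 ≤ D v ∧ 0 ≤ l v ∧ f v ^ 2 ≤ l v * D v := by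
    refine ind _ ?_ ?_
    · intro v hv; simp [hD0 v hv, hl0 v hv, hf v hv]
    · rintro v hv ⟨h1, h2, h3⟩
      rw [hD v hv, hl v hv]
      refine ⟨by positivity, by positivity, ?_⟩
      set a := f (p v)
      set b := f v - a with hb
      have : f v = a + b := by rw [hb]; ring
      rw [this]
      -- 2ab ≤ D + l b²
      have key : 2 * a * b ≤ D (p v) + l (p v) * b ^ 2 := by
        rcases h2.eq_or_lt with h0 | h0
        · rw [← h0] at h3 ⊢
          have : a = 0 := by nlinarith
          rw [this]; linarith
        · have h5 : a ^ 2 / l (p v) ≤ D (p v) := by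
            rw [div_le_iff₀ h0]; linarith
          have h6 : a ^ 2 / l (p v) + l (p v) * b ^ 2 - 2 * a * b = (a - l (p v) * b) ^ 2 / l (p v) := by
            field_simp; ring
          have : 0 ≤ (a - l (p v) * b) ^ 2 / l (p v) := by positivity
          linarith
      nlinarith
  have hQs : ∀ v, v ∉ S → R v + Q (p v) ≤ s := by
    refine ind _ ?_ ?_
    · intro v hv h; exact absurd hv h
    · intro v hv ih _
      by_cases h : p v ∈ S
      · rw [hQ0 _ h]; linarith [((hnS v).1 hv).2]
      · rw [hQ _ h]; linarith [ih h, hRp v hv]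
  have hQs' : ∀ v, Q v ≤ s := by
    intro v
    by_cases h : v ∈ S
    · rw [hQ0 v h]; exact hs0.le
    · rw [hQ v h]; linarith [hQs v h, hRw v]
  have hlQ : ∀ v, d * l v ≤ 4 * Q v + d * g v := by
    refine ind _ ?_ ?_
    · intro v hv; rw [hl0 v hv, hQ0 v hv]; simp; positivity
    · intro v hv ih
      rw [hl v hv, hQ v hv]
      have hd0 : (0 : ℝ) ≤ d := by positivity
      by_cases h : v ∈ T
      · have h1 : (g (p v) : ℝ) ≤ 3 := by exact_mod_cast hg (p v)
        have h2 : w v = 1 + d := by simp [w, h]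
        have h3 : (0 : ℝ) ≤ g v := by positivity
        nlinarith [mul_le_mul_of_nonneg_left h1 hd0, mul_nonneg hd0 h3]
      · have h1 : (g (p v) : ℝ) + 1 ≤ g v := by exact_mod_cast (hp v ((hnS v).1 hv).1).2 h
        nlinarith [mul_le_mul_of_nonneg_left h1 hd0, hw v]
  have hl7 : ∀ v, d * l v ≤ 7 * s := by
    intro v
    have h1 : (g v : ℝ) ≤ 3 := by exact_mod_cast hg v
    have := mul_le_mul_of_nonneg_left h1 (by positivity : (0 : ℝ) ≤ d)
    linarith [hlQ v, hQs' v]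
  set E := ∑ x, (if x ≠ ρ then (f x - f (p x)) ^ 2 else 0) with hE
  have hDsum : ∑ v, D v ≤ s * E := by
    calc ∑ v, D v ≤ ∑ v, D v * w v := Finset.sum_le_sum fun v _ => by nlinarith [hw v, (hDl v).1]
      _ = ∑ v, (D v * R v - if v ∉ S then D (p v) * R v else 0) := by
        rw [hsumm, Finset.sum_sub_distrib]
      _ ≤ ∑ v, s * (if v ≠ ρ then (f v - f (p v)) ^ 2 else 0) := by
        refine Finset.sum_le_sum fun v _ => ?_
        by_cases h : v ∈ S
        · simp only [hD0 v h, h, not_true, if_false]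
          simp only [zero_mul, sub_zero]
          split_ifs <;> positivity
        · have h' := (hnS v).1 h
          rw [if_pos h, if_pos h'.1, hD v h]
          nlinarith [mul_le_mul_of_nonneg_right h'.2 (sq_nonneg (f v - f (p v)))]
      _ = s * E := by rw [Finset.mul_sum]
  have h1 : d * ∑ x, f x ^ 2 ≤ 7 * s * ∑ v, D v := by
    rw [Finset.mul_sum, Finset.mul_sum]
    refine Finset.sum_le_sum fun v _ => ?_
    have := mul_le_mul_of_nonneg_right (hl7 v) (hDl v).1
    have := mul_le_mul_of_nonneg_left (hDl v).2.2 (by positivity : (0 : ℝ) ≤ d)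
    linarith
  have h2 : d * ∑ x, f x ^ 2 ≤ 7 * s * (s * E) :=
    h1.trans (mul_le_mul_of_nonneg_left hDsum (by positivity))
  have h3 := mul_le_mul_of_nonneg_left h2 (by positivity : (0 : ℝ) ≤ (j : ℝ) ^ 2)
  calc d * j ^ 2 * ∑ x, f x ^ 2 = j ^ 2 * (d * ∑ x, f x ^ 2) := by ring
    _ ≤ _ := h3
    _ = 7 * (s * j) ^ 2 * E := by ring
    _ = _ := by rw [hsj]; ring

/-- For any connected, unweighted, `d`-regular finite graph on `n` vertices and any
`1 ≤ k ≤ n`, the `k`-th smallest normalized Laplacian eigenvalue satisfies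
`λ_k ≥ (k-1)²/(100 n²)`.  (Here `lam` lists the eigenvalues in increasing order,
indexed from `0`, so `lam k` is `λ_{k+1}`.) -/
theorem stmt9 {n : ℕ} (G : SimpleGraph (Fin n)) [DecidableRel G.Adj]
    (d : ℕ) (hreg : G.IsRegularOfDegree d) (hconn : G.Connected)
    (hL : (normLapG G).IsHermitian)
    (lam : Fin n → ℝ) (hmono : Monotone lam)
    (hperm : ∃ σ : Equiv.Perm (Fin n), lam = hL.eigenvalues ∘ σ) :
    ∀ k : Fin n, ((k : ℕ) : ℝ) ^ 2 / (100 * n ^ 2) ≤ lam k := by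
  intro k
  obtain ⟨σ, hσ⟩ := hperm
  have hn : 1 ≤ n := by have := k.2; omega
  have hn' : (0 : ℝ) < n := by exact_mod_cast hn
  have hquad0 : 1 ≤ d → ∀ f : Fin n → ℝ, 0 ≤ 2 * d * (dotProduct f (Matrix.mulVec (normLapG G) f)) := by
    intro hd f
    rw [quad G d hd hreg]
    refine Finset.sum_nonneg fun x _ => Finset.sum_nonneg fun y _ => ?_
    split_ifs <;> positivity
  rcases Nat.eq_zero_or_pos (k : ℕ) with hk | hk
  · rw [hk]
    simp only [Nat.cast_zero, ne_eq, OfNat.ofNat_ne_zero, not_false_eq_true, zero_pow, zero_div]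
    obtain ⟨f, -, hf, hfl⟩ := courant _ hL lam hmono σ hσ k ∅ (by simp)
    have h0 : 0 ≤ dotProduct f (Matrix.mulVec (normLapG G) f) := by
      rcases Nat.eq_zero_or_pos d with hd | hd
      · have : normLapG G = 1 := by
          ext x y
          rw [normLap_apply G d hreg, hd, Matrix.one_apply]; simp
        rw [this, Matrix.one_mulVec]
        exact Finset.sum_nonneg fun x _ => mul_self_nonneg _
      · have := hquad0 hd f
        have hd' : (0 : ℝ) < 2 * d := by positivity
        exact nonneg_of_mul_nonneg_right this hd'
    exact nonneg_of_mul_nonneg_left (h0.trans hfl) hf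
  have hd : 1 ≤ d := by
    have : Nontrivial (Fin n) := Fin.nontrivial_iff_two_le.2 (by have := k.2; omega)
    obtain ⟨u, hu⟩ := hconn.preconnected.exists_adj_of_nontrivial k
    rw [← hreg k]
    exact (G.degree_pos_iff_exists_adj k).2 ⟨u, hu⟩
  have hd' : (0 : ℝ) < d := by exact_mod_cast hd
  have hk' : (0 : ℝ) < (k : ℕ) := by exact_mod_cast hk
  have hkn : ((k : ℕ) : ℝ) ≤ n := by exact_mod_cast k.2.le
  by_cases hdk : (d : ℝ) * (k : ℕ) ≤ 2 * n
  · obtain ⟨T, p, r, g, hp, hg, hT⟩ := tree_exists G d hreg hconn k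
    rw [Fintype.card_fin] at hT
    obtain ⟨S, hS, hpo⟩ := poincare k p r g T d n k hk hn (Fintype.card_fin n)
      (fun x hx => (hp x hx).2) hg hT hdk
    obtain ⟨f, hfS, hf, hfl⟩ := courant _ hL lam hmono σ hσ k S hS
    have h1 := hpo f hfS
    have h2 : ∑ x, (if x ≠ k then (f x - f (p x)) ^ 2 else 0) ≤
        2 * d * (dotProduct f (Matrix.mulVec (normLapG G) f)) := by
      rw [quad G d hd hreg]
      refine Finset.sum_le_sum fun x _ => ?_
      have hnn : ∀ y ∈ Finset.univ, 0 ≤ (if G.Adj x y then (1 : ℝ) else 0) * (f x - f y) ^ 2 := by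
        intro y _
        split_ifs <;> positivity
      split_ifs with hx
      · have := Finset.single_le_sum hnn (Finset.mem_univ (p x))
        rwa [if_pos (hp x hx).1, one_mul] at this
      · exact Finset.sum_nonneg hnn
    have h3 : d * (k : ℕ) ^ 2 * ∑ x, f x ^ 2 ≤ 28 * n ^ 2 * (2 * d * (lam k * ∑ x, f x ^ 2)) := by
      refine h1.trans (mul_le_mul_of_nonneg_left (h2.trans ?_) (by positivity))
      exact mul_le_mul_of_nonneg_left hfl (by positivity)
    have h4 : ((k : ℕ) : ℝ) ^ 2 ≤ 56 * n ^ 2 * lam k := by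
      refine le_of_mul_le_mul_left ?_ (mul_pos hd' hf)
      calc _ = d * (k : ℕ) ^ 2 * ∑ x, f x ^ 2 := by ring
        _ ≤ _ := h3
        _ = _ := by ring
    have h5 : 0 ≤ n ^ 2 * lam k := by
      have : (0 : ℝ) ≤ (k : ℕ) ^ 2 := by positivity
      linarith
    rw [div_le_iff₀ (by positivity)]
    linarith
  · push Not at hdk
    have h100 : ((k : ℕ) : ℝ) ^ 2 / (100 * n ^ 2) ≤ 1 / 100 := by
      rw [div_le_div_iff₀ (by positivity) (by norm_num)]
      nlinarith
    refine h100.trans ?_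
    by_contra hlt
    push Not at hlt
    have h1 := eig_sum G d hd hreg hL
    rw [← Equiv.sum_comp σ] at h1
    have h2 : ∑ i ∈ Finset.Iic k, (1 / 2 : ℝ) ≤ ∑ i, (1 - hL.eigenvalues (σ i)) ^ 2 := by
      refine (Finset.sum_le_sum fun i hi => ?_).trans
        (Finset.sum_le_sum_of_subset_of_nonneg (Finset.subset_univ (Finset.Iic k))
          fun _ _ _ => sq_nonneg _)
      have h3 : lam i ≤ lam k := hmono (Finset.mem_Iic.1 hi)
      have h4 : lam i = hL.eigenvalues (σ i) := by rw [hσ]; rfl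
      rw [← h4]
      nlinarith
    rw [h1, Finset.sum_const, Fin.card_Iic, nsmul_eq_mul, le_div_iff₀ hd'] at h2
    push_cast at h2
    nlinarith
end

section
/- For every finite, unweighted, connected graph G on n vertices and every k with 2 ≤ k ≤ n, the k-th smallest eigenvalue of the normalized Laplacian satisfies λ_k > (k−1)³/(3200 n³). -/
lemma aux_biUnion {V : Type*} [DecidableEq V] (S : Finset V) (t : V → Finset V) (p : V → ℝ)
    (hp : ∀ x, 0 ≤ p x) : ∑ x ∈ S.biUnion t, p x ≤ ∑ s ∈ S, ∑ x ∈ t s, p x := by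
  induction S using Finset.induction_on with
  | empty => simp
  | insert a S ha ih =>
    rw [Finset.biUnion_insert, Finset.sum_insert ha]
    have h := Finset.sum_union_inter (s₁ := t a) (s₂ := S.biUnion t) (f := p)
    have h' : 0 ≤ ∑ x ∈ t a ∩ S.biUnion t, p x := Finset.sum_nonneg fun x _ => hp x
    linarith

open Finset in
lemma aux_pack {V E : Type*} [DecidableEq V] [NormedAddCommGroup E] (F : V → E) :
    ∀ (N : ℕ) (A : Finset V), A.card ≤ N → (∀ y ∈ A, F y ≠ 0) →
    ∃ S ⊆ A, (∀ y ∈ A, ∃ s ∈ S, ‖F y - F s‖ < 1/2 * ‖F s‖) ∧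
      (∀ s ∈ S, ∀ t ∈ S, s ≠ t → 1/2 * ‖F s‖ ≤ ‖F s - F t‖ ∧ 1/2 * ‖F t‖ ≤ ‖F s - F t‖) := by
  classical
  intro N
  induction N with
  | zero =>
    intro A hA _
    have : A = ∅ := by simpa using hA
    subst this
    exact ⟨∅, by simp⟩
  | succ N ih =>
    intro A hA hne
    rcases A.eq_empty_or_nonempty with rfl | hAn
    · exact ⟨∅, by simp⟩
    obtain ⟨s, hs, hmax⟩ := A.exists_max_image (fun y => ‖F y‖) hAn
    have hpos : 0 < ‖F s‖ := norm_pos_iff.mpr (hne s hs)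
    set A' := A.filter (fun y => ¬ ‖F y - F s‖ < 1/2 * ‖F s‖) with hA'
    have hsub : A' ⊆ A := filter_subset _ _
    have hlt : A'.card < A.card := by
      apply card_lt_card
      refine ⟨hsub, fun h => ?_⟩
      have := (mem_filter.mp (h hs)).2
      rw [sub_self, norm_zero] at this
      exact this (by linarith)
    obtain ⟨S, hSA, hcov, hsep⟩ := ih A' (by omega) (fun y hy => hne y (hsub hy))
    have key : ∀ t ∈ S, 1/2 * ‖F s‖ ≤ ‖F s - F t‖ ∧ 1/2 * ‖F t‖ ≤ ‖F s - F t‖ := by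
      intro t ht
      have h1 := (mem_filter.mp (hSA ht)).2
      have h2 := hmax t (hsub (hSA ht))
      rw [norm_sub_rev] at h1
      constructor <;> linarith
    refine ⟨insert s S, ?_, ?_, ?_⟩
    · intro y hy
      rcases mem_insert.mp hy with rfl | hy
      · exact hs
      · exact hsub (hSA hy)
    · intro y hy
      by_cases h : ‖F y - F s‖ < 1/2 * ‖F s‖
      · exact ⟨s, mem_insert_self _ _, h⟩
      · obtain ⟨t, ht, h'⟩ := hcov y (mem_filter.mpr ⟨hy, h⟩)
        exact ⟨t, mem_insert_of_mem ht, h'⟩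
    · intro a ha b hb hab
      rcases mem_insert.mp ha with rfl | ha'
      · rcases mem_insert.mp hb with rfl | hb
        · exact absurd rfl hab
        · exact key b hb
      · rcases mem_insert.mp hb with rfl | hb
        · have := key a ha'
          rw [norm_sub_rev (F a)]
          exact ⟨this.2, this.1⟩
        · exact hsep a ha' b hb hab

/-- A path leaving `B`. -/
lemma aux_path {V E : Type*} [DecidableEq V] [NormedAddCommGroup E] (G : SimpleGraph V)
    (F : V → E) (h : V → ℝ) (hh : ∀ x y, G.Adj x y → ‖F x - F y‖ ≤ h x) (B : Finset V) :
    ∀ {u z : V} (p : G.Walk u z), p.IsPath → u ∈ B → z ∉ B →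
    ∃ S ⊆ B, (∀ y ∈ S, y ∈ p.support) ∧ ∃ w, w ∉ B ∧ ‖F u - F w‖ ≤ ∑ y ∈ S, h y := by
  intro u z p
  induction p with
  | nil => intro _ h1 h2; exact absurd h1 h2
  | @cons u v z huv p ih =>
    intro hp hu hz
    rw [SimpleGraph.Walk.cons_isPath_iff] at hp
    by_cases hv : v ∈ B
    · obtain ⟨S, hSB, hSp, w, hw, hle⟩ := ih hp.1 hv hz
      have huS : u ∉ S := fun hu' => hp.2 (hSp u hu')
      refine ⟨insert u S, Finset.insert_subset hu hSB, ?_, w, hw, ?_⟩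
      · intro y hy
        rcases Finset.mem_insert.mp hy with rfl | hy
        · simp
        · simp [hSp y hy]
      · rw [Finset.sum_insert huS]
        have := norm_sub_le_norm_sub_add_norm_sub (F u) (F v) (F w)
        have := hh u v huv
        linarith
    · refine ⟨{u}, by simpa using hu, by simp, v, hv, ?_⟩
      simpa using hh u v huv

open Finset in
lemma aux_ball {V E : Type*} [Fintype V] [DecidableEq V] [NormedAddCommGroup E]
    (G : SimpleGraph V) [DecidableRel G.Adj] (hconn : G.Connected) (F : V → E) (x : V)
    (B : Finset V) (ρ : ℝ) (hρ : 0 ≤ ρ) (hxB : x ∈ B) (hout : ∃ z, z ∉ B)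
    (hB : ∀ z, z ∉ B → ρ ≤ ‖F x - F z‖) :
    ρ ^ 2 * G.degree x / (B.card : ℝ) ^ 2 ≤
      ∑ y ∈ B, ∑ z ∈ G.neighborFinset y, ‖F y - F z‖ ^ 2 := by
  set e : V → ℝ := fun y => ∑ z ∈ G.neighborFinset y, ‖F y - F z‖ ^ 2 with he
  have he0 : ∀ y, 0 ≤ e y := fun y => sum_nonneg fun z _ => by positivity
  have hs : (1:ℝ) ≤ B.card := by
    exact_mod_cast card_pos.mpr ⟨x, hxB⟩
  set s : ℝ := (B.card : ℝ) with hsdef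
  obtain ⟨z, hz⟩ := hout
  have hh : ∀ a b, G.Adj a b → ‖F a - F b‖ ≤ Real.sqrt (e a) := by
    intro a b hab
    apply Real.le_sqrt_of_sq_le
    exact single_le_sum (f := fun z => ‖F a - F z‖ ^ 2) (fun z _ => by positivity)
      ((G.mem_neighborFinset a b).mpr hab)
  have h1 : ρ ^ 2 / s ≤ ∑ y ∈ B, e y := by
    obtain ⟨p⟩ := hconn.preconnected x z
    obtain ⟨S, hSB, -, w, hw, hle⟩ :=
      aux_path G F (fun a => Real.sqrt (e a)) hh B (p.toPath : G.Walk x z) p.toPath.2 hxB hz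
    have h2 : ρ ≤ ∑ y ∈ S, Real.sqrt (e y) := (hB w hw).trans hle
    have h3 : ρ ^ 2 ≤ (∑ y ∈ S, Real.sqrt (e y)) ^ 2 := by gcongr
    have h4 : (∑ y ∈ S, Real.sqrt (e y)) ^ 2 ≤ S.card * ∑ y ∈ S, (Real.sqrt (e y)) ^ 2 :=
      sq_sum_le_card_mul_sum_sq
    have h5 : ∑ y ∈ S, (Real.sqrt (e y)) ^ 2 = ∑ y ∈ S, e y :=
      sum_congr rfl fun y _ => Real.sq_sqrt (he0 y)
    have h6 : ∑ y ∈ S, e y ≤ ∑ y ∈ B, e y :=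
      sum_le_sum_of_subset_of_nonneg hSB fun y _ _ => he0 y
    have h7 : (S.card : ℝ) ≤ s := by
      rw [hsdef]; exact_mod_cast card_le_card hSB
    have h8 : 0 ≤ ∑ y ∈ S, e y := sum_nonneg fun y _ => he0 y
    rw [div_le_iff₀ (by linarith)]
    rw [h5] at h4
    nlinarith [mul_le_mul h7 h6 h8 (by linarith)]
  have h2 : ((G.degree x : ℝ) - s + 1) * ρ ^ 2 ≤ ∑ y ∈ B, e y := by
    have h3 : e x ≤ ∑ y ∈ B, e y := single_le_sum (fun y _ => he0 y) hxB
    have h4 : ∑ z ∈ G.neighborFinset x \ B.erase x, ρ ^ 2 ≤ e x := by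
      calc _ ≤ ∑ z ∈ G.neighborFinset x \ B.erase x, ‖F x - F z‖ ^ 2 := by
            apply sum_le_sum
            intro z hz
            rw [mem_sdiff, mem_erase, SimpleGraph.mem_neighborFinset] at hz
            have hne : z ≠ x := fun h => by subst h; exact G.loopless.irrefl _ hz.1
            have hzB : z ∉ B := fun h => hz.2 ⟨hne, h⟩
            have := hB z hzB
            gcongr
        _ ≤ _ := sum_le_sum_of_subset_of_nonneg sdiff_subset fun y _ _ => by positivity
    rw [sum_const, nsmul_eq_mul] at h4
    have h5 : (G.degree x : ℝ) - s + 1 ≤ ((G.neighborFinset x \ B.erase x).card : ℝ) := by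
      have h6 := le_card_sdiff (B.erase x) (G.neighborFinset x)
      rw [card_erase_of_mem hxB, SimpleGraph.card_neighborFinset_eq_degree] at h6
      have h7 : 1 ≤ B.card := card_pos.mpr ⟨x, hxB⟩
      have h8 : G.degree x + 1 ≤ (G.neighborFinset x \ B.erase x).card + B.card := by omega
      have h9 : (G.degree x : ℝ) + 1 ≤ ((G.neighborFinset x \ B.erase x).card : ℝ) + B.card := by
        exact_mod_cast h8
      linarith
    nlinarith [mul_le_mul_of_nonneg_right h5 (sq_nonneg ρ)]
  set d : ℝ := (G.degree x : ℝ)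
  rcases le_total d s with hds | hds
  · refine le_trans ?_ h1
    rw [div_le_div_iff₀ (by positivity) (by linarith)]
    have : 0 ≤ ρ ^ 2 * s * (s - d) := by
      apply mul_nonneg (by positivity); linarith
    nlinarith
  · refine le_trans ?_ h2
    rw [div_le_iff₀ (by positivity)]
    have h3 : d ≤ (d - s + 1) * s := by nlinarith
    have h4 : (d - s + 1) * s ≤ (d - s + 1) * s ^ 2 := by
      apply mul_le_mul_of_nonneg_left _ (by linarith); nlinarith
    nlinarith [mul_le_mul_of_nonneg_left (h3.trans h4) (sq_nonneg ρ)]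

/-- Power mean inequality in the form needed. -/
lemma aux_holder {ι : Type*} (S : Finset ι) (s : ι → ℝ) (n : ℝ) (hn : 0 < n)
    (hs : ∀ i ∈ S, 0 < s i) (hsum : ∑ i ∈ S, s i ≤ n) :
    (S.card : ℝ) ^ 3 / n ^ 2 ≤ ∑ i ∈ S, 1 / s i ^ 2 := by
  set m : ℝ := (S.card : ℝ) with hm
  have hm0 : 0 ≤ m := by positivity
  have h : ∀ i ∈ S, 3 * (m / n) ^ 2 - 2 * (m / n) ^ 3 * s i ≤ 1 / s i ^ 2 := by
    intro i hi
    have h0 := hs i hi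
    rw [le_div_iff₀ (by positivity)]
    have ht : 0 ≤ (m / n) * s i := by positivity
    nlinarith [mul_nonneg (sq_nonneg ((m / n) * s i - 1))
      (by linarith : 0 ≤ 2 * ((m / n) * s i) + 1)]
  have h2 := Finset.sum_le_sum h
  rw [Finset.sum_sub_distrib, ← Finset.mul_sum S s, Finset.sum_const, nsmul_eq_mul, ← hm] at h2
  have h3 : 2 * (m / n) ^ 3 * ∑ i ∈ S, s i ≤ 2 * (m / n) ^ 3 * n :=
    mul_le_mul_of_nonneg_left hsum (by positivity)
  have h4 : m * (3 * (m / n) ^ 2) - 2 * (m / n) ^ 3 * n = m ^ 3 / n ^ 2 := by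
    field_simp; ring
  linarith

open Finset in
lemma aux_main {V E : Type*} [Fintype V] [DecidableEq V] [NormedAddCommGroup E]
    [InnerProductSpace ℝ E]
    (G : SimpleGraph V) [DecidableRel G.Adj] (hconn : G.Connected) (F : V → E) (K : ℝ) (hK : 0 < K)
    (h1 : ∑ x, (G.degree x : ℝ) * ‖F x‖ ^ 2 = K)
    (h2 : ∀ v, ∑ y, (G.degree y : ℝ) * (inner ℝ (F y) v) ^ 2 ≤ ‖v‖ ^ 2)
    (h3 : ∀ v, ∑ y, (G.degree y : ℝ) * (inner ℝ (F y) v) = 0) :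
    729 / 262144 * K ^ 4 / (Fintype.card V : ℝ) ^ 3 ≤
      ∑ y, ∑ z ∈ G.neighborFinset y, ‖F y - F z‖ ^ 2 := by
  classical
  have : Nonempty V := hconn.nonempty
  set n : ℝ := (Fintype.card V : ℝ) with hn
  have hn0 : 0 < n := by rw [hn]; exact_mod_cast Fintype.card_pos
  set p : V → ℝ := fun x => (G.degree x : ℝ) * ‖F x‖ ^ 2 with hp
  have hp0 : ∀ x, 0 ≤ p x := fun x => by positivity
  set A : Finset V := univ.filter (fun x => K / (4 * n) ≤ p x) with hA
  have hAne : ∀ y ∈ A, 0 < p y := by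
    intro y hy
    have := (mem_filter.mp hy).2
    have : 0 < K / (4 * n) := by positivity
    linarith
  have hAF : ∀ y ∈ A, F y ≠ 0 := by
    intro y hy h0
    have := hAne y hy
    simp [hp, h0] at this
  have hAmass : 3 / 4 * K ≤ ∑ x ∈ A, p x := by
    have hsplit := sum_filter_add_sum_filter_not univ (fun x => K / (4 * n) ≤ p x) p
    have hle : ∑ x ∈ univ.filter (fun x => ¬ K / (4 * n) ≤ p x), p x ≤ K / 4 := by
      calc _ ≤ ∑ x ∈ univ.filter (fun x => ¬ K / (4 * n) ≤ p x), K / (4 * n) :=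
            sum_le_sum fun x hx => (not_le.mp (mem_filter.mp hx).2).le
        _ ≤ ∑ x : V, K / (4 * n) :=
            sum_le_sum_of_subset_of_nonneg (filter_subset _ _) fun _ _ _ => by positivity
        _ = K / 4 := by
            rw [sum_const, nsmul_eq_mul, card_univ, ← hn]; field_simp
    rw [h1] at hsplit
    linarith
  obtain ⟨S, hSA, hcov, hsep⟩ := aux_pack F A.card A le_rfl hAF
  -- mass of a ball
  have hmass : ∀ s ∈ S, ∑ y ∈ univ.filter (fun y => ‖F y - F s‖ < 1/2 * ‖F s‖), p y ≤ 4 / 3 := by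
    intro s hs
    have hpos : 0 < ‖F s‖ := norm_pos_iff.mpr (hAF s (hSA hs))
    have hstep : ∑ y ∈ univ.filter (fun y => ‖F y - F s‖ < 1/2 * ‖F s‖),
        3 / 4 * ‖F s‖ ^ 2 * p y ≤ ‖F s‖ ^ 2 := by
      refine le_trans ?_ (h2 (F s))
      refine le_trans (sum_le_sum (g := fun y => (G.degree y : ℝ) * (inner ℝ (F y) (F s)) ^ 2) ?_)
        (sum_le_sum_of_subset_of_nonneg (filter_subset _ _) fun _ _ _ => by positivity)
      intro y hy
      have hy := (mem_filter.mp hy).2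
      have hsq : ‖F y - F s‖ ^ 2 ≤ 1/4 * ‖F s‖ ^ 2 := by
        have := norm_nonneg (F y - F s)
        nlinarith
      rw [norm_sub_sq_real] at hsq
      have hc : 3 / 4 * ‖F s‖ ^ 2 * ‖F y‖ ^ 2 ≤ (inner ℝ (F y) (F s)) ^ 2 := by
        generalize (inner ℝ (F y) (F s) : ℝ) = c at *
        have ha : 0 ≤ ‖F y‖ ^ 2 := by positivity
        have hb : 0 ≤ ‖F s‖ ^ 2 := by positivity
        generalize ‖F y‖ ^ 2 = a at *
        generalize ‖F s‖ ^ 2 = b at *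
        have h : a + 3 / 4 * b ≤ 2 * c := by linarith
        have h' : (a + 3 / 4 * b) ^ 2 ≤ (2 * c) ^ 2 := by gcongr
        nlinarith [sq_nonneg (a - 3 / 4 * b)]
      simp only [hp]
      nlinarith [mul_le_mul_of_nonneg_left hc (Nat.cast_nonneg (α := ℝ) (G.degree y))]
    rw [← mul_sum] at hstep
    have hb : 0 < ‖F s‖ ^ 2 := by positivity
    by_contra hcon
    push Not at hcon
    nlinarith [mul_lt_mul_of_pos_left hcon hb]
  have hScard : 9 / 16 * K ≤ (S.card : ℝ) := by
    have h4 : ∑ x ∈ A, p x ≤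
        ∑ s ∈ S, ∑ y ∈ univ.filter (fun y => ‖F y - F s‖ < 1/2 * ‖F s‖), p y := by
      calc _ ≤ ∑ x ∈ S.biUnion (fun s => univ.filter (fun y => ‖F y - F s‖ < 1/2 * ‖F s‖)), p x := by
            apply sum_le_sum_of_subset_of_nonneg
            · intro y hy
              obtain ⟨s, hs, h⟩ := hcov y hy
              simp only [mem_biUnion, mem_filter, mem_univ, true_and]
              exact ⟨s, hs, h⟩
            · intro _ _ _; exact hp0 _
        _ ≤ _ := by
            exact aux_biUnion S _ p hp0
    have h5 := h4.trans (sum_le_sum hmass)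
    rw [sum_const, nsmul_eq_mul] at h5
    linarith
  set B : V → Finset V := fun s => univ.filter (fun y => ‖F s - F y‖ < 1/4 * ‖F s‖) with hBdef
  have hdisj : (S : Set V).PairwiseDisjoint B := by
    intro s hs t ht hst
    rw [Function.onFun, Finset.disjoint_left]
    intro y hy1 hy2
    have hy1 := (mem_filter.mp hy1).2
    have hy2 := (mem_filter.mp hy2).2
    rw [norm_sub_rev] at hy2
    have := norm_sub_le_norm_sub_add_norm_sub (F s) (F y) (F t)
    have := hsep s hs t ht hst
    linarith
  have hmem : ∀ s ∈ S, s ∈ B s := by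
    intro s hs
    have hpos : 0 < ‖F s‖ := norm_pos_iff.mpr (hAF s (hSA hs))
    simp [hBdef, hpos, hAF s (hSA hs)]
  have hball : ∀ s ∈ S, K / (64 * n) * (1 / ((B s).card : ℝ) ^ 2) ≤
      ∑ y ∈ B s, ∑ z ∈ G.neighborFinset y, ‖F y - F z‖ ^ 2 := by
    intro s hs
    have hpos : 0 < ‖F s‖ := norm_pos_iff.mpr (hAF s (hSA hs))
    have hout : ∃ z, z ∉ B s := by
      by_contra hcon
      push Not at hcon
      have hin : ∀ y, 0 < (inner ℝ (F y) (F s) : ℝ) := by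
        intro y
        have hy := (mem_filter.mp (hcon y)).2
        have hsq : ‖F s - F y‖ ^ 2 < ‖F s‖ ^ 2 := by
          have := norm_nonneg (F s - F y)
          nlinarith
        rw [norm_sub_sq_real, real_inner_comm] at hsq
        nlinarith [sq_nonneg ‖F y‖]
      have hd : 0 < (G.degree s : ℝ) := by
        have h := hAne s (hSA hs)
        simp only [hp] at h
        exact pos_of_mul_pos_left h (by positivity)
      have h4 := h3 (F s)
      have h5 : 0 < ∑ y, (G.degree y : ℝ) * (inner ℝ (F y) (F s)) :=
        sum_pos' (fun y _ => mul_nonneg (by positivity) (hin y).le)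
          ⟨s, mem_univ _, mul_pos hd (hin s)⟩
      linarith
    have h4 := aux_ball G hconn F s (B s) (1/4 * ‖F s‖) (by positivity) (hmem s hs) hout (by
      intro z hz
      by_contra hcon
      exact hz (mem_filter.mpr ⟨mem_univ _, not_le.mp hcon⟩))
    refine le_trans ?_ h4
    have h5 : K / (4 * n) ≤ p s := (mem_filter.mp (hSA hs)).2
    have h6 : K / (64 * n) ≤ (1/4 * ‖F s‖) ^ 2 * G.degree s := by
      have : K / (64 * n) = (K / (4 * n)) / 16 := by field_simp; norm_num
      simp only [hp] at h5
      nlinarith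
    rw [mul_one_div]
    gcongr
  have hcards : ∑ s ∈ S, ((B s).card : ℝ) ≤ n := by
    rw [hn]
    have := card_biUnion (s := S) (t := B) (fun s hs t ht hst => hdisj hs ht hst)
    have h4 : (S.biUnion B).card ≤ Fintype.card V := card_le_univ _
    rw [this] at h4
    exact_mod_cast h4
  have hhold := aux_holder S (fun s => ((B s).card : ℝ)) n hn0
    (fun s hs => by exact_mod_cast card_pos.mpr ⟨s, hmem s hs⟩) hcards
  have htot : ∑ s ∈ S, ∑ y ∈ B s, ∑ z ∈ G.neighborFinset y, ‖F y - F z‖ ^ 2 ≤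
      ∑ y, ∑ z ∈ G.neighborFinset y, ‖F y - F z‖ ^ 2 := by
    rw [← sum_biUnion hdisj]
    exact sum_le_sum_of_subset_of_nonneg (subset_univ _)
      fun _ _ _ => sum_nonneg fun _ _ => by positivity
  have hfin := (sum_le_sum hball).trans htot
  rw [← mul_sum] at hfin
  refine le_trans ?_ hfin
  have hc3 : (9 / 16 * K) ^ 3 ≤ (S.card : ℝ) ^ 3 := by gcongr
  calc 729 / 262144 * K ^ 4 / n ^ 3 = K / (64 * n) * ((9 / 16 * K) ^ 3 / n ^ 2) := by
        field_simp; norm_num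
    _ ≤ K / (64 * n) * ((S.card : ℝ) ^ 3 / n ^ 2) := by gcongr
    _ ≤ _ := by gcongr


lemma aux_energy {n : ℕ} (G : SimpleGraph (Fin n)) [DecidableRel G.Adj]
    (hd : ∀ x, 0 < (G.degree x : ℝ)) (w : Fin n → ℝ) :
    ∑ x, ∑ y ∈ G.neighborFinset x,
      (w x / Real.sqrt (G.degree x) - w y / Real.sqrt (G.degree y)) ^ 2 =
      2 * ∑ x, w x * ((normLapG G).mulVec w) x := by
  have hsq : ∀ x, Real.sqrt (G.degree x) ^ 2 = G.degree x := fun x => Real.sq_sqrt (hd x).le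
  have hs0 : ∀ x, Real.sqrt (G.degree x) ≠ 0 := fun x => (Real.sqrt_pos.mpr (hd x)).ne'
  set g : Fin n → ℝ := fun x => w x / Real.sqrt (G.degree x) with hg
  have hN : ∀ (f : Fin n → ℝ) x, ∑ y ∈ G.neighborFinset x, f y = ∑ y, if G.Adj x y then f y else 0 := by
    intro f x
    rw [← Finset.sum_filter]
    congr 1
    ext y; simp
  have hLw : ∀ x, w x * ((normLapG G).mulVec w) x =
      w x ^ 2 - ∑ y ∈ G.neighborFinset x, g x * g y := by
    intro x
    rw [hN]
    simp only [Matrix.mulVec, dotProduct, normLapG, Matrix.of_apply, sub_mul,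
      Finset.sum_sub_distrib, ite_mul, one_mul, zero_mul, Finset.sum_ite_eq, Finset.mem_univ,
      if_true, mul_sub]
    congr 1
    · ring
    · rw [Finset.mul_sum]
      refine Finset.sum_congr rfl fun y _ => ?_
      split_ifs
      · simp only [hg]; field_simp [hs0 x, hs0 y]
      · simp
  have hA : ∑ x, ∑ y ∈ G.neighborFinset x, g x ^ 2 = ∑ x, w x ^ 2 := by
    refine Finset.sum_congr rfl fun x _ => ?_
    rw [Finset.sum_const, nsmul_eq_mul, SimpleGraph.card_neighborFinset_eq_degree]
    simp only [hg]
    rw [div_pow, hsq]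
    have := (hd x).ne'
    field_simp
  have hB : ∑ x, ∑ y ∈ G.neighborFinset x, g y ^ 2 = ∑ x, w x ^ 2 := by
    rw [← hA]
    simp only [hN (fun y => g y ^ 2)]
    rw [Finset.sum_comm]
    refine Finset.sum_congr rfl fun x _ => ?_
    rw [hN (fun _ => g x ^ 2)]
    simp only [G.adj_comm]
  have hexp : ∀ x y, (g x - g y) ^ 2 = g x ^ 2 + g y ^ 2 - 2 * (g x * g y) := by
    intro x y; ring
  have hgoal : ∑ x, ∑ y ∈ G.neighborFinset x, (g x - g y) ^ 2 =
      2 * ∑ x, w x * ((normLapG G).mulVec w) x := by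
    simp only [hexp, Finset.sum_sub_distrib, Finset.sum_add_distrib, hA, hB, hLw]
    simp only [← Finset.mul_sum]
    ring
  exact hgoal

lemma aux_subspace {E : Type*} [NormedAddCommGroup E] [InnerProductSpace ℝ E]
    [FiniteDimensional ℝ E] {m : ℕ} (v : Fin (m + 1) → E) (hv : Orthonormal ℝ v) (u : E) :
    ∃ W : Submodule ℝ E, W ≤ Submodule.span ℝ (Set.range v) ∧ (∀ w ∈ W, inner ℝ u w = 0) ∧
      m ≤ Module.finrank ℝ W := by
  set W0 := Submodule.span ℝ (Set.range v)
  have h0 : Module.finrank ℝ W0 = m + 1 := by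
    simpa using finrank_span_eq_card hv.linearIndependent
  set U := Submodule.span ℝ ({u} : Set E)
  refine ⟨W0 ⊓ Uᗮ, inf_le_left, ?_, ?_⟩
  · intro w hw
    exact Submodule.mem_orthogonal_singleton_iff_inner_right.mp hw.2
  · have h1 := Submodule.finrank_sup_add_finrank_inf_eq W0 Uᗮ
    have h2 := Submodule.finrank_add_finrank_orthogonal U
    have h3 : Module.finrank ℝ U ≤ 1 := finrank_span_le_card ({u} : Set E) |>.trans (by simp)
    have h4 := Submodule.finrank_le (W0 ⊔ Uᗮ)
    omega

lemma aux_rayleigh {n m : ℕ} (L : Matrix (Fin n) (Fin n) ℝ)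
    (v : Fin (m + 1) → EuclideanSpace ℝ (Fin n)) (hv : Orthonormal ℝ v) (mu : Fin (m + 1) → ℝ)
    (l : ℝ) (hmu : ∀ i, mu i ≤ l) (hev : ∀ i, Matrix.toEuclideanLin L (v i) = mu i • v i)
    (w : EuclideanSpace ℝ (Fin n)) (hw : w ∈ Submodule.span ℝ (Set.range v)) :
    inner ℝ w (Matrix.toEuclideanLin L w) ≤ l * ‖w‖ ^ 2 := by
  obtain ⟨c, rfl⟩ := (Submodule.mem_span_range_iff_exists_fun ℝ).mp hw
  have h1 : Matrix.toEuclideanLin L (∑ i, c i • v i) = ∑ i, (c i * mu i) • v i := by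
    simp [map_sum, hev, smul_smul]
  rw [h1, hv.inner_sum, ← real_inner_self_eq_norm_sq, hv.inner_sum, Finset.mul_sum]
  refine Finset.sum_le_sum fun i _ => ?_
  simp only [conj_trivial]
  nlinarith [hmu i, mul_le_mul_of_nonneg_right (hmu i) (mul_self_nonneg (c i))]

/-- For any finite, unweighted, connected graph on `n` vertices and any `2 ≤ k ≤ n`,
the `k`-th smallest normalized Laplacian eigenvalue satisfies
`λ_k > (k-1)³/(3200 n³)`.  (Here `lam` lists the eigenvalues in increasing order,
indexed from `0`, so `lam k` is `λ_{k+1}`.) -/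
theorem stmt10 {n : ℕ} (G : SimpleGraph (Fin n)) [DecidableRel G.Adj]
    (hconn : G.Connected)
    (hL : (normLapG G).IsHermitian)
    (lam : Fin n → ℝ) (hmono : Monotone lam)
    (hperm : ∃ σ : Equiv.Perm (Fin n), lam = hL.eigenvalues ∘ σ) :
    ∀ k : Fin n, 1 ≤ (k : ℕ) → ((k : ℕ) : ℝ) ^ 3 / (3200 * n ^ 3) < lam k := by
  classical
  obtain ⟨σ, hσ⟩ := hperm
  intro k hk
  have hkn := k.isLt
  have : Nontrivial (Fin n) := Fin.nontrivial_iff_two_le.mpr (by omega)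
  have hd : ∀ x, 0 < (G.degree x : ℝ) := fun x => by
    exact_mod_cast hconn.preconnected.degree_pos_of_nontrivial x
  have hsq : ∀ x, Real.sqrt (G.degree x) ^ 2 = G.degree x := fun x => Real.sq_sqrt (hd x).le
  have hs0 : ∀ x, Real.sqrt (G.degree x) ≠ 0 := fun x => (Real.sqrt_pos.mpr (hd x)).ne'
  let ι : Fin ((k : ℕ) + 1) → Fin n := fun i => ⟨i, by omega⟩
  let v : Fin ((k : ℕ) + 1) → EuclideanSpace ℝ (Fin n) := fun i => hL.eigenvectorBasis (σ (ι i))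
  have hv : Orthonormal ℝ v := by
    apply hL.eigenvectorBasis.orthonormal.comp
    intro i j hij
    have := σ.injective hij
    simp only [ι, Fin.mk.injEq] at this
    exact Fin.ext this
  have hev : ∀ i, Matrix.toEuclideanLin (normLapG G) (v i) = lam (ι i) • v i := by
    intro i
    have := hL.mulVec_eigenvectorBasis (σ (ι i))
    rw [hσ]
    ext j
    simpa [Matrix.toEuclideanLin] using congrFun this j
  have hmu : ∀ i, lam (ι i) ≤ lam k := fun i => hmono (by
    rw [Fin.le_def]; simp only [ι]; omega)
  obtain ⟨W, hW, hWu, hWd⟩ := aux_subspace v hv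
    (WithLp.toLp 2 (fun x => Real.sqrt (G.degree x)) : EuclideanSpace ℝ (Fin n))
  let b := stdOrthonormalBasis ℝ W
  set K := Module.finrank ℝ W with hK
  let bb : Fin K → EuclideanSpace ℝ (Fin n) := fun i => (b i : EuclideanSpace ℝ (Fin n))
  have hbb : Orthonormal ℝ bb := b.orthonormal.comp_linearIsometry W.subtypeₗᵢ
  have hbW : ∀ i, bb i ∈ W := fun i => (b i).2
  let F : Fin n → EuclideanSpace ℝ (Fin K) :=
    fun x => WithLp.toLp 2 (fun i => bb i x / Real.sqrt (G.degree x))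
  have hKpos : (1 : ℝ) ≤ K := by exact_mod_cast hk.trans hWd
  have hnb : ∀ i, ∑ x, (bb i x) ^ 2 = 1 := by
    intro i
    have := hbb.1 i
    have h2 : ‖bb i‖ ^ 2 = 1 := by rw [this]; norm_num
    rwa [EuclideanSpace.real_norm_sq_eq] at h2
  have hinner : ∀ (y : Fin n) (c : EuclideanSpace ℝ (Fin K)),
      inner ℝ (F y) c = (∑ i, c i * bb i y) / Real.sqrt (G.degree y) := by
    intro y c
    simp only [F, PiLp.inner_apply, RCLike.inner_apply, conj_trivial, Finset.sum_div]
    refine Finset.sum_congr rfl fun i _ => ?_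
    ring
  have H1 : ∑ x, (G.degree x : ℝ) * ‖F x‖ ^ 2 = K := by
    have : ∀ x, (G.degree x : ℝ) * ‖F x‖ ^ 2 = ∑ i, (bb i x) ^ 2 := by
      intro x
      rw [EuclideanSpace.real_norm_sq_eq, Finset.mul_sum]
      refine Finset.sum_congr rfl fun i _ => ?_
      simp only [F, div_pow, hsq]
      have := (hd x).ne'
      field_simp
    simp only [this]
    rw [Finset.sum_comm]
    simp [hnb]
  have H2 : ∀ c, ∑ y, (G.degree y : ℝ) * (inner ℝ (F y) c) ^ 2 ≤ ‖c‖ ^ 2 := by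
    intro c
    apply le_of_eq
    have h1 : ∀ y, (G.degree y : ℝ) * (inner ℝ (F y) c) ^ 2 = ((∑ i, c i • bb i) y) ^ 2 := by
      intro y
      rw [hinner, div_pow, hsq]
      have := (hd y).ne'
      simp only [WithLp.ofLp_sum, Finset.sum_apply, PiLp.smul_apply, smul_eq_mul]
      field_simp
    simp only [h1]
    rw [← EuclideanSpace.real_norm_sq_eq, ← real_inner_self_eq_norm_sq, hbb.inner_sum,
      EuclideanSpace.real_norm_sq_eq]
    simp [sq]
  have H3 : ∀ c, ∑ y, (G.degree y : ℝ) * (inner ℝ (F y) c) = 0 := by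
    intro c
    have h0 := hWu (∑ i, c i • bb i) (W.sum_mem fun i _ => W.smul_mem _ (hbW i))
    rw [PiLp.inner_apply] at h0
    rw [← h0]
    refine Finset.sum_congr rfl fun y _ => ?_
    rw [hinner]
    simp only [WithLp.ofLp_sum, Finset.sum_apply, PiLp.smul_apply, smul_eq_mul,
      RCLike.inner_apply, conj_trivial]
    have := hs0 y
    nth_rewrite 1 [← hsq y]
    field_simp
  have hmain := aux_main G hconn F K (by linarith) H1 H2 H3
  have hen : ∑ y, ∑ z ∈ G.neighborFinset y, ‖F y - F z‖ ^ 2 ≤ 2 * K * lam k := by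
    have h1 : ∑ y, ∑ z ∈ G.neighborFinset y, ‖F y - F z‖ ^ 2 =
        ∑ i, ∑ y, ∑ z ∈ G.neighborFinset y,
          (bb i y / Real.sqrt (G.degree y) - bb i z / Real.sqrt (G.degree z)) ^ 2 := by
      rw [Finset.sum_comm]
      refine Finset.sum_congr rfl fun y _ => ?_
      rw [Finset.sum_comm]
      refine Finset.sum_congr rfl fun z _ => ?_
      rw [EuclideanSpace.real_norm_sq_eq]
      rfl
    rw [h1]
    have h2 : ∀ i ∈ Finset.univ, ∑ y, ∑ z ∈ G.neighborFinset y,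
          (bb i y / Real.sqrt (G.degree y) - bb i z / Real.sqrt (G.degree z)) ^ 2 ≤ 2 * lam k := by
      intro i _
      rw [aux_energy G hd (fun x => bb i x)]
      have h3 := aux_rayleigh (normLapG G) v hv (fun i => lam (ι i)) (lam k) hmu hev (bb i)
        (hW (hbW i))
      rw [hbb.1 i, PiLp.inner_apply] at h3
      have h4 : ∑ x, bb i x * ((normLapG G).mulVec (fun x => bb i x)) x =
          ∑ x, inner ℝ (bb i x) ((Matrix.toEuclideanLin (normLapG G) (bb i)) x) := by
        refine Finset.sum_congr rfl fun x _ => ?_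
        simp only [RCLike.inner_apply, conj_trivial]
        rw [mul_comm]
        rfl
      rw [h4]
      linarith
    refine (Finset.sum_le_sum h2).trans (le_of_eq ?_)
    simp
    ring
  rw [Fintype.card_fin] at hmain
  have hn0 : (0 : ℝ) < n := by exact_mod_cast (by omega : 0 < n)
  have hk0 : (1 : ℝ) ≤ ((k : ℕ) : ℝ) := by exact_mod_cast hk
  have hkK : ((k : ℕ) : ℝ) ≤ K := by exact_mod_cast hWd
  have hK3 : ((k : ℕ) : ℝ) ^ 3 ≤ (K : ℝ) ^ 3 := by gcongr
  have hk3 : 0 < ((k : ℕ) : ℝ) ^ 3 := by positivity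
  have h5 := hmain.trans hen
  rw [div_le_iff₀ (by positivity)] at h5
  rw [div_lt_iff₀ (by positivity)]
  have h6 : 729 / 262144 * (K : ℝ) ^ 3 ≤ 2 * lam k * n ^ 3 := by
    have hK0 : (0 : ℝ) < K := by linarith
    refine le_of_mul_le_mul_left ?_ hK0
    nlinarith
  nlinarith
end
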